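/- Let a, c ∈ C¹([−1,1]) with a(0) = 0 and (c − a'/2)(x) ≥ γ > 0 on [−1,1], let f ∈ C¹([−1,1]), λ > 0, 0 < ε ≤ 1, and let u ∈ C²([−1,1]) with u(−1) = u(1) = 0 solve −ε u'' + a u' + c u = f on (−1,1) and satisfy |u^{(i)}(x)| ≤ C_u (1 + (ε^{1/2} + |x|)^{λ−i}) for i = 0, 1. Let −1 = x_{−N} < … < x_N = 1 be an arbitrary mesh, u_I the continuous piecewise linear interpolant of u, and u_N ∈ V^N the piecewise linear Galerkin solution, i.e. B_ε(u_N, v_N) = ∫_{−1}^{1} f v_N for all v_N ∈ V^N. Then there is a constant C, independent of ε, N and the mesh, such that |||u_I − u_N|||_ε ≤ C ‖u − u_I‖^{1/2}. -/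

import Mathlib

/-- The bilinear form `B_ε(v,w) = ε∫ v'w' + ∫ a v' w + ∫ c v w` over `(-1,1)`,
with derivatives taken pointwise (piecewise for mesh functions; the finitely many
mesh points do not affect the integrals). -/
noncomputable def Beps (ε : ℝ) (a c : ℝ → ℝ) (v w : ℝ → ℝ) : ℝ :=
  ε * (∫ y in (-1:ℝ)..1, deriv v y * deriv w y)
    + (∫ y in (-1:ℝ)..1, a y * deriv v y * w y)
    + (∫ y in (-1:ℝ)..1, c y * v y * w y)

/-- The energy norm `|||v|||_ε = (ε∫ (v')² + ∫ v²)^{1/2}` over `(-1,1)`. -/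
noncomputable def energyNorm (ε : ℝ) (v : ℝ → ℝ) : ℝ :=
  Real.sqrt (ε * (∫ y in (-1:ℝ)..1, (deriv v y)^2) + ∫ y in (-1:ℝ)..1, (v y)^2)

/-- Membership in the piecewise linear space `V^N`: continuous on `[-1,1]`,
vanishing at `±1`, and affine on every mesh interval `[x_{i-1}, x_i]`. -/
def MemVN1 (x : ℤ → ℝ) (N : ℕ) (v : ℝ → ℝ) : Prop :=
  ContinuousOn v (Set.Icc (-1) 1) ∧ v (-1) = 0 ∧ v 1 = 0 ∧
  ∀ i : ℤ, -(N:ℤ) < i → i ≤ N → ∀ y ∈ Set.Icc (x (i-1)) (x i),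
    v y = v (x (i-1)) + (v (x i) - v (x (i-1))) / (x i - x (i-1)) * (y - x (i-1))

section

open MeasureTheory Set

/-- `g` is measurable and essentially bounded on `(-1,1]`. -/
@[fun_prop]
structure BddMeas (g : ℝ → ℝ) : Prop where
  aesm : AEStronglyMeasurable g (volume.restrict (Ioc (-1) 1))
  bdd : ∃ M, ∀ᵐ y ∂volume.restrict (Ioc (-1 : ℝ) 1), |g y| ≤ M

namespace BddMeas
variable {g h : ℝ → ℝ}

@[fun_prop]
theorem const (r : ℝ) : BddMeas fun _ => r :=
  ⟨aestronglyMeasurable_const, |r|, by simp⟩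

@[fun_prop]
theorem add (hg : BddMeas g) (hh : BddMeas h) : BddMeas fun y => g y + h y := by
  obtain ⟨M, hM⟩ := hg.bdd
  obtain ⟨K, hK⟩ := hh.bdd
  refine ⟨hg.aesm.add hh.aesm, M + K, ?_⟩
  filter_upwards [hM, hK] with y h1 h2
  exact (abs_add_le _ _).trans (add_le_add h1 h2)

@[fun_prop]
theorem mul (hg : BddMeas g) (hh : BddMeas h) : BddMeas fun y => g y * h y := by
  obtain ⟨M, hM⟩ := hg.bdd
  obtain ⟨K, hK⟩ := hh.bdd
  refine ⟨hg.aesm.mul hh.aesm, M * K, ?_⟩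
  filter_upwards [hM, hK] with y h1 h2
  rw [abs_mul]
  gcongr
  exact (abs_nonneg _).trans h1

@[fun_prop]
theorem neg (hg : BddMeas g) : BddMeas fun y => -g y := by
  simpa using (const (-1)).mul hg

@[fun_prop]
theorem sub (hg : BddMeas g) (hh : BddMeas h) : BddMeas fun y => g y - h y := by
  simpa [sub_eq_add_neg] using hg.add hh.neg

@[fun_prop]
theorem div_const (hg : BddMeas g) (r : ℝ) : BddMeas fun y => g y / r := by
  simpa [div_eq_mul_inv] using hg.mul (const r⁻¹)

@[fun_prop]
theorem pow (hg : BddMeas g) (n : ℕ) : BddMeas fun y => g y ^ n := by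
  induction n with
  | zero => simpa using const 1
  | succ n ih => simpa [pow_succ] using ih.mul hg

theorem of_continuousOn (hg : ContinuousOn g (Icc (-1) 1)) : BddMeas g := by
  obtain ⟨M, hM⟩ := isCompact_Icc.exists_bound_of_continuousOn hg
  refine ⟨(hg.mono Ioc_subset_Icc_self).aestronglyMeasurable measurableSet_Ioc, M, ?_⟩
  filter_upwards [ae_restrict_mem measurableSet_Ioc] with y hy
  exact hM y (Ioc_subset_Icc_self hy)

theorem intervalIntegrable (hg : BddMeas g) : IntervalIntegrable g volume (-1) 1 := by
  obtain ⟨M, hM⟩ := hg.bdd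
  rw [intervalIntegrable_iff_integrableOn_Ioc_of_le (by norm_num)]
  exact Integrable.of_bound hg.aesm M hM

theorem integral_add (hg : BddMeas g) (hh : BddMeas h) :
    ∫ y in (-1 : ℝ)..1, (g y + h y) = (∫ y in (-1 : ℝ)..1, g y) + ∫ y in (-1 : ℝ)..1, h y :=
  intervalIntegral.integral_add hg.intervalIntegrable hh.intervalIntegrable

theorem integral_sub (hg : BddMeas g) (hh : BddMeas h) :
    ∫ y in (-1 : ℝ)..1, (g y - h y) = (∫ y in (-1 : ℝ)..1, g y) - ∫ y in (-1 : ℝ)..1, h y :=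
  intervalIntegral.integral_sub hg.intervalIntegrable hh.intervalIntegrable

theorem integral_mono {S : Set ℝ} (hS : S.Countable) (hg : BddMeas g) (hh : BddMeas h)
    (hle : ∀ y ∈ Ioo (-1 : ℝ) 1 \ S, g y ≤ h y) :
    ∫ y in (-1 : ℝ)..1, g y ≤ ∫ y in (-1 : ℝ)..1, h y := by
  have h1 : (-1 : ℝ) ≤ 1 := by norm_num
  rw [intervalIntegral.integral_of_le h1, intervalIntegral.integral_of_le h1,
    integral_Ioc_eq_integral_Ioo, integral_Ioc_eq_integral_Ioo]
  have hgi := ((intervalIntegrable_iff_integrableOn_Ioo_of_le h1).1 hg.intervalIntegrable)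
  have hhi := ((intervalIntegrable_iff_integrableOn_Ioo_of_le h1).1 hh.intervalIntegrable)
  refine integral_mono_ae hgi hhi ?_
  filter_upwards [ae_restrict_mem measurableSet_Ioo, hS.ae_notMem _] with y hy hyS
  exact hle y ⟨hy, hyS⟩

end BddMeas

/-- `g` is continuous on `[-1,1]` and has the bounded measurable derivative `g'` at the points
of `(-1,1)` outside the exceptional set `S`. -/
structure PiecewiseC1 (S : Set ℝ) (g g' : ℝ → ℝ) : Prop where
  cont : ContinuousOn g (Icc (-1) 1)
  bddMeas' : BddMeas g'
  deriv : ∀ y ∈ Ioo (-1 : ℝ) 1 \ S, HasDerivAt g (g' y) y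

namespace PiecewiseC1
variable {S : Set ℝ} {g g' h h' : ℝ → ℝ}

theorem bddMeas (hg : PiecewiseC1 S g g') : BddMeas g := .of_continuousOn hg.cont

theorem mul (hg : PiecewiseC1 S g g') (hh : PiecewiseC1 S h h') :
    PiecewiseC1 S (fun y => g y * h y) (fun y => g' y * h y + g y * h' y) := by
  have := hg.bddMeas
  have := hh.bddMeas
  have := hg.bddMeas'
  have := hh.bddMeas'
  exact ⟨hg.cont.mul hh.cont, by fun_prop, fun y hy => (hg.deriv y hy).mul (hh.deriv y hy)⟩

theorem add (hg : PiecewiseC1 S g g') (hh : PiecewiseC1 S h h') :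
    PiecewiseC1 S (fun y => g y + h y) (fun y => g' y + h' y) := by
  have := hg.bddMeas'
  have := hh.bddMeas'
  exact ⟨hg.cont.add hh.cont, by fun_prop, fun y hy => (hg.deriv y hy).add (hh.deriv y hy)⟩

theorem sub (hg : PiecewiseC1 S g g') (hh : PiecewiseC1 S h h') :
    PiecewiseC1 S (fun y => g y - h y) (fun y => g' y - h' y) := by
  have := hg.bddMeas'
  have := hh.bddMeas'
  exact ⟨hg.cont.sub hh.cont, by fun_prop, fun y hy => (hg.deriv y hy).sub (hh.deriv y hy)⟩

theorem integral_deriv (hS : S.Countable) (hg : PiecewiseC1 S g g') :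
    ∫ y in (-1 : ℝ)..1, g' y = g 1 - g (-1) :=
  integral_eq_of_hasDerivAt_off_countable_of_le g g' (by norm_num) hS hg.cont hg.deriv
    hg.bddMeas'.intervalIntegrable

theorem of_contDiffOn (hg : ContDiffOn ℝ 1 g (Icc (-1) 1)) :
    PiecewiseC1 S g (derivWithin g (Icc (-1) 1)) := by
  refine ⟨hg.continuousOn, .of_continuousOn (hg.continuousOn_derivWithin
    (uniqueDiffOn_Icc (by norm_num)) le_rfl), fun y hy => ?_⟩
  have hmem : Icc (-1 : ℝ) 1 ∈ nhds y := Icc_mem_nhds hy.1.1 hy.1.2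
  exact ((hg.differentiableOn one_ne_zero y
    (Ioo_subset_Icc_self hy.1)).hasDerivWithinAt).hasDerivAt hmem

end PiecewiseC1

theorem abs_mul_le_of_abs_le {x y A B : ℝ} (hx : |x| ≤ A) (hy : |y| ≤ B) : |x * y| ≤ A * B := by
  rw [abs_mul]
  exact mul_le_mul hx hy (abs_nonneg _) ((abs_nonneg _).trans hx)

/-- If `q' = a q / ε + R`, then testing with `a q` shows that `‖a q‖² = O(ε)`. -/
theorem integral_sq_mul_sq_le {S : Set ℝ} (hS : S.Countable) {a a' q q' R : ℝ → ℝ} {ε M : ℝ}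
    (hε : 0 < ε) (hM : 1 ≤ M) (ha : PiecewiseC1 S a a') (hq : PiecewiseC1 S q q')
    (hq' : ∀ y ∈ Ioo (-1 : ℝ) 1 \ S, q' y = a y * q y / ε + R y)
    (haM : ∀ y ∈ Icc (-1 : ℝ) 1, |a y| ≤ M) (haM' : ∀ y ∈ Icc (-1 : ℝ) 1, |a' y| ≤ M)
    (hqM : ∀ y ∈ Icc (-1 : ℝ) 1, |q y| ≤ M) (hRM : ∀ y ∈ Icc (-1 : ℝ) 1, |a y * R y| ≤ M) :
    ∫ y in (-1 : ℝ)..1, (a y * q y) ^ 2 ≤ 4 * M ^ 3 * ε := by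
  have hW := (hq.mul hq).mul ha
  have hval := hW.integral_deriv hS
  have hWB := hW.bddMeas'
  have := ha.bddMeas
  have := hq.bddMeas
  have hb : ∀ y ∈ Icc (-1 : ℝ) 1, |q y * q y * a y| ≤ M * M * M := fun y hy =>
    abs_mul_le_of_abs_le (abs_mul_le_of_abs_le (hqM y hy) (hqM y hy)) (haM y hy)
  have hmono := BddMeas.integral_mono hS (g := fun y => 2 / ε * (a y * q y) ^ 2)
    (h := fun y => ((q' y * q y + q y * q' y) * a y + q y * q y * a' y) + 3 * M ^ 3)
    (by fun_prop) (by fun_prop) (fun y hy => by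
      have hy' := Ioo_subset_Icc_self hy.1
      have e1 := neg_le_of_abs_le (abs_mul_le_of_abs_le (hRM y hy') (hqM y hy'))
      have e2 := neg_le_of_abs_le (abs_mul_le_of_abs_le
        (abs_mul_le_of_abs_le (hqM y hy') (hqM y hy')) (haM' y hy'))
      have e3 : M * M ≤ M ^ 3 := by
        nlinarith [mul_pos (zero_lt_one.trans_le hM) (zero_lt_one.trans_le hM)]
      have e4 : 2 / ε * (a y * q y) ^ 2 = (q' y * q y + q y * q' y) * a y
          - 2 * (a y * R y * q y) := by
        rw [hq' y hy]; field_simp; ring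
      rw [e4]
      linarith)
  rw [BddMeas.integral_add (by fun_prop) (by fun_prop), hval,
    intervalIntegral.integral_const_mul, intervalIntegral.integral_const] at hmono
  have b1 := le_of_abs_le (hb 1 (by norm_num))
  have b2 := neg_le_of_abs_le (hb (-1) (by norm_num))
  rw [div_mul_eq_mul_div, div_le_iff₀ hε] at hmono
  norm_num at hmono
  nlinarith

/-- If `q' = a q / ε + R` and `a m` vanishes at `±1`, then `a² m q / ε` is bounded in `L²`
uniformly in `ε`. -/
theorem integral_sq_cutoff_le {S : Set ℝ} (hS : S.Countable) {a a' q q' R m m' : ℝ → ℝ} {ε M : ℝ}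
    (hε : 0 < ε) (hM : 1 ≤ M) (ha : PiecewiseC1 S a a') (hq : PiecewiseC1 S q q')
    (hm : PiecewiseC1 S m m')
    (hq' : ∀ y ∈ Ioo (-1 : ℝ) 1 \ S, q' y = a y * q y / ε + R y)
    (haM : ∀ y ∈ Icc (-1 : ℝ) 1, |a y| ≤ M) (haM' : ∀ y ∈ Icc (-1 : ℝ) 1, |a' y| ≤ M)
    (hmM : ∀ y ∈ Icc (-1 : ℝ) 1, |m y| ≤ M) (hmM' : ∀ y ∈ Icc (-1 : ℝ) 1, |m' y| ≤ M)
    (hqM : ∀ y ∈ Icc (-1 : ℝ) 1, |q y| ≤ M) (hRM : ∀ y ∈ Icc (-1 : ℝ) 1, |a y * R y| ≤ M)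
    (hl : a (-1) * m (-1) = 0) (hr : a 1 * m 1 = 0) :
    ∫ y in (-1 : ℝ)..1, (a y ^ 2 * m y * q y / ε) ^ 2 ≤ 98 * M ^ 6 := by
  have ham := ha.mul hm
  have hW := ((ham.mul ham).mul ha).mul (hq.mul hq)
  have hval := hW.integral_deriv hS
  have hWB := hW.bddMeas'
  have := ha.bddMeas
  have := hq.bddMeas
  have := hm.bddMeas
  simp only [hl, hr, zero_mul, sub_zero] at hval
  have hmono := BddMeas.integral_mono hS
    (h := fun y => (1 / ε) * ((((a' y * m y + a y * m' y) * (a y * m y)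
            + a y * m y * (a' y * m y + a y * m' y)) * a y +
            a y * m y * (a y * m y) * a' y) *
          (q y * q y) +
        a y * m y * (a y * m y) * a y * (q' y * q y + q y * q' y)) + 49 * M ^ 6)
    (g := fun y => (a y ^ 2 * m y * q y / ε) ^ 2)
    (by fun_prop) (by fun_prop) (fun y hy => by
      have hy' := Ioo_subset_Icc_self hy.1
      have e1 := abs_mul_le_of_abs_le (hRM y hy') (hmM y hy')
      have e2 := abs_mul_le_of_abs_le (abs_mul_le_of_abs_le (hqM y hy') (haM' y hy')) (hmM y hy')
      have e3 := abs_mul_le_of_abs_le (abs_mul_le_of_abs_le (hqM y hy') (haM y hy')) (hmM' y hy')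
      have e4 : M * M ≤ M * M * M := by nlinarith
      have hG : (2 * (a y * R y * m y) + 3 * (q y * a' y * m y) + 2 * (q y * a y * m' y)) ^ 2
          ≤ (7 * (M * M * M)) ^ 2 := by
        rw [sq_le_sq]
        refine le_trans ?_ (le_abs_self _)
        rw [abs_le] at *
        constructor <;> linarith
      generalize hGdef : 2 * (a y * R y * m y) + 3 * (q y * a' y * m y)
        + 2 * (q y * a y * m' y) = G at hG
      generalize hZdef : a y ^ 2 * m y * q y / ε = Z
      have key : (1 / ε) * ((((a' y * m y + a y * m' y) * (a y * m y)
            + a y * m y * (a' y * m y + a y * m' y)) * a y +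
            a y * m y * (a y * m y) * a' y) *
          (q y * q y) +
        a y * m y * (a y * m y) * a y * (q' y * q y + q y * q' y)) = 2 * Z ^ 2 + Z * G := by
        rw [hq' y hy, ← hZdef, ← hGdef]; field_simp; ring
      rw [key]
      nlinarith [sq_nonneg (Z + G), sq_nonneg Z])
  rw [BddMeas.integral_add (by fun_prop) (by fun_prop),
    intervalIntegral.integral_const_mul, hval, intervalIntegral.integral_const] at hmono
  norm_num at hmono
  linarith

theorem mul_le_sq_add_sq (x y : ℝ) : x * y ≤ 1 / 4 * y ^ 2 + x ^ 2 := by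
  linarith [sq_nonneg (y / 2 - x)]

theorem integral_sq_le_of_abs_le {S : Set ℝ} {w w' : ℝ → ℝ} {M : ℝ}
    (hw : PiecewiseC1 S w w') (hwM : ∀ y ∈ Icc (-1 : ℝ) 1, |w y| ≤ M) :
    ∫ y in (-1 : ℝ)..1, w y ^ 2 ≤ 2 * M ^ 2 := by
  have := hw.bddMeas
  have h := BddMeas.integral_mono countable_empty (g := fun y => w y ^ 2) (h := fun _ => M ^ 2)
    (by fun_prop) (by fun_prop) (fun y hy => by
      have h1 := hwM y (Ioo_subset_Icc_self hy.1)
      exact sq_le_sq' (neg_le_of_abs_le h1) (le_of_abs_le h1))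
  rw [intervalIntegral.integral_const] at h
  norm_num at h
  linarith

set_option maxHeartbeats 1000000 in
/-- The weighted derivative `a w'` of the interpolation error satisfies `‖a w'‖² = O(‖w‖)`
as long as `ε ≤ ‖w‖`. -/
theorem integral_sq_mul_deriv_le {S : Set ℝ} (hS : S.Countable)
    {a a' q q' R k k' p s w w' d : ℝ → ℝ} {ε M t : ℝ}
    (hε : 0 < ε) (hM : 1 ≤ M) (ha : PiecewiseC1 S a a') (hq : PiecewiseC1 S q q')
    (hk : PiecewiseC1 S k k') (hp : PiecewiseC1 S p s) (hw : PiecewiseC1 S w w')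
    (hd : BddMeas d)
    (hq' : ∀ y ∈ Ioo (-1 : ℝ) 1 \ S, q' y = a y * q y / ε + R y)
    (hs : ∀ y ∈ Ioo (-1 : ℝ) 1 \ S, s y = q y / ε)
    (hw' : ∀ y ∈ Ioo (-1 : ℝ) 1 \ S, w' y = p y - d y)
    (haM : ∀ y ∈ Icc (-1 : ℝ) 1, |a y| ≤ M) (haM' : ∀ y ∈ Icc (-1 : ℝ) 1, |a' y| ≤ M)
    (hkM : ∀ y ∈ Icc (-1 : ℝ) 1, |k y| ≤ M) (hkM' : ∀ y ∈ Icc (-1 : ℝ) 1, |k' y| ≤ M)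
    (hqM : ∀ y ∈ Icc (-1 : ℝ) 1, |q y| ≤ M) (hRM : ∀ y ∈ Icc (-1 : ℝ) 1, |a y * R y| ≤ M)
    (hwl : w (-1) = 0) (hwr : w 1 = 0)
    (horth : ∫ y in (-1 : ℝ)..1,
      ((a' y * a y + a y * a' y) * w y + a y * a y * w' y) * d y = 0)
    (hX : ∫ y in (-1 : ℝ)..1, (a y * q y) ^ 2 ≤ 4 * M ^ 3 * ε)
    (hZ : ∫ y in (-1 : ℝ)..1, (a y ^ 2 * (1 - a y * k y) * q y / ε) ^ 2 ≤ 98 * M ^ 6)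
    (ht : ∫ y in (-1 : ℝ)..1, w y ^ 2 = t ^ 2) (hεt : ε ≤ t) (htM : t ≤ 2 * M) :
    ∫ y in (-1 : ℝ)..1, (a y * w' y) ^ 2 ≤ 300 * M ^ 8 * t := by
  have ht0 : 0 < t := hε.trans_le hεt
  have hM0 : 0 < M := zero_lt_one.trans_le hM
  have hV := (ha.mul ha).mul hw
  have hW1 := hV.mul hp
  have hW2 := (hV.mul hk).mul hq
  have hv1 := hW1.integral_deriv hS
  have hv2 := hW2.integral_deriv hS
  have hb1 := hW1.bddMeas'
  have hb2 := hW2.bddMeas'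
  have hbV := hV.bddMeas'
  have := ha.bddMeas
  have := hq.bddMeas
  have := hk.bddMeas
  have := hw.bddMeas
  have := hw.bddMeas'
  simp only [hwl, hwr, mul_zero, zero_mul, sub_zero] at hv1 hv2
  have hmono := BddMeas.integral_mono hS
    (g := fun y => 1 / 2 * (a y * w' y) ^ 2)
    (h := fun y => (((((((a' y * a y + a y * a' y) * w y + a y * a y * w' y) * p y
          + a y * a y * w y * s y)
        - ((a' y * a y + a y * a' y) * w y + a y * a y * w' y) * d y)
        - ((((a' y * a y + a y * a' y) * w y + a y * a y * w' y) * k y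
          + a y * a y * w y * k' y) * q y + a y * a y * w y * k y * q' y))
        + (4 * M ^ 2 + 1 / (2 * t)) * w y ^ 2) + M ^ 2 * (a y * q y) ^ 2)
        + (t * (a y ^ 2 * (1 - a y * k y) * q y / ε) ^ 2 + t * (16 * M ^ 8)))
    (by fun_prop) (by fun_prop) (fun y hy => by
      have hy' := Ioo_subset_Icc_self hy.1
      have e1 := abs_mul_le_of_abs_le (abs_mul_le_of_abs_le (haM y hy') (haM' y hy'))
        (abs_mul_le_of_abs_le (hkM y hy') (hqM y hy'))
      have e2 := abs_mul_le_of_abs_le (abs_mul_le_of_abs_le (haM y hy') (haM y hy'))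
        (abs_mul_le_of_abs_le (hkM' y hy') (hqM y hy'))
      have e3 := abs_mul_le_of_abs_le (abs_mul_le_of_abs_le (haM y hy') (hkM y hy'))
        (hRM y hy')
      have e4 : M * M * M * 1 ≤ M * M * M * M := by gcongr
      generalize hZdef : a y ^ 2 * (1 - a y * k y) * q y / ε = Z
      obtain ⟨G, hGdef⟩ : ∃ G, G = 2 * (a y * a' y * (k y * q y)) + a y * a y * (k' y * q y)
        + a y * k y * (a y * R y) := ⟨_, rfl⟩
      have hG : G ^ 2 ≤ (4 * (M * M * M * M)) ^ 2 := by
        rw [sq_le_sq, hGdef]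
        refine le_trans ?_ (le_abs_self _)
        rw [abs_le] at *
        constructor <;> linarith
      have key : (a y * w' y) ^ 2 =
          ((((a' y * a y + a y * a' y) * w y + a y * a y * w' y) * p y
          + a y * a y * w y * s y)
        - ((a' y * a y + a y * a' y) * w y + a y * a y * w' y) * d y)
        - ((((a' y * a y + a y * a' y) * w y + a y * a y * w' y) * k y
          + a y * a y * w y * k' y) * q y + a y * a y * w y * k y * q' y)
        - 2 * (a' y * w y) * (a y * w' y) + (a y * q y * k y) * (a y * w' y)
        + w y * (G - Z) := by
        rw [hs y hy, hq' y hy, ← hZdef, hGdef, hw' y hy]; field_simp; ring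
      have y1 : -(2 * (a' y * w y) * (a y * w' y))
          ≤ 1 / 4 * (a y * w' y) ^ 2 + 4 * M ^ 2 * w y ^ 2 := by
        have h1 : (a' y * w y) ^ 2 ≤ M ^ 2 * w y ^ 2 := by
          rw [mul_pow]; gcongr ?_ * _; exact sq_le_sq.2 ((haM' y hy').trans (le_abs_self _))
        linarith [mul_le_sq_add_sq (-2 * (a' y * w y)) (a y * w' y)]
      have y2 : (a y * q y * k y) * (a y * w' y)
          ≤ 1 / 4 * (a y * w' y) ^ 2 + M ^ 2 * (a y * q y) ^ 2 := by
        have h1 : (a y * q y * k y) ^ 2 ≤ M ^ 2 * (a y * q y) ^ 2 := by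
          rw [mul_pow, mul_comm]; gcongr ?_ * _
          exact sq_le_sq.2 ((hkM y hy').trans (le_abs_self _))
        linarith [mul_le_sq_add_sq (a y * q y * k y) (a y * w' y)]
      have y3 : w y * (G - Z) ≤ 1 / (2 * t) * w y ^ 2 + (t * Z ^ 2 + t * (16 * M ^ 8)) := by
        have h1 : (G - Z) ^ 2 ≤ 2 * Z ^ 2 + 32 * M ^ 8 := by
          linarith [sq_nonneg (G + Z)]
        have h2 : w y * (G - Z) ≤ 1 / (2 * t) * w y ^ 2 + t / 2 * (G - Z) ^ 2 := by
          have h3 : 1 / (2 * t) * w y ^ 2 + t / 2 * (G - Z) ^ 2 - w y * (G - Z)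
              = (w y - t * (G - Z)) ^ 2 / (2 * t) := by field_simp; ring
          have h4 : 0 ≤ (w y - t * (G - Z)) ^ 2 / (2 * t) := by positivity
          linarith
        linarith [mul_le_mul_of_nonneg_left h1 (half_pos ht0).le]
      linarith)
  rw [BddMeas.integral_add (by fun_prop) (by fun_prop),
    BddMeas.integral_add (by fun_prop) (by fun_prop),
    BddMeas.integral_add (by fun_prop) (by fun_prop),
    BddMeas.integral_sub (by fun_prop) (by fun_prop),
    BddMeas.integral_sub (by fun_prop) (by fun_prop), hv1, hv2, horth,
    BddMeas.integral_add (by fun_prop) (by fun_prop),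
    intervalIntegral.integral_const_mul, intervalIntegral.integral_const_mul,
    intervalIntegral.integral_const_mul, intervalIntegral.integral_const_mul,
    intervalIntegral.integral_const, ht] at hmono
  have z1 : (4 * M ^ 2 + 1 / (2 * t)) * t ^ 2 ≤ (8 * M ^ 3 + 1 / 2) * t := by
    have : (4 * M ^ 2 + 1 / (2 * t)) * t ^ 2 = (4 * M ^ 2 * t + 1 / 2) * t := by field_simp
    rw [this]
    have h1 := mul_le_mul_of_nonneg_left htM (by positivity : 0 ≤ 4 * M ^ 2)
    exact mul_le_mul_of_nonneg_right (by linarith) ht0.le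
  have z2 : M ^ 2 * ∫ y in (-1 : ℝ)..1, (a y * q y) ^ 2 ≤ 4 * M ^ 5 * t := by
    calc _ ≤ M ^ 2 * (4 * M ^ 3 * t) := by gcongr; exact hX.trans (by gcongr)
      _ = _ := by ring
  have z3 := mul_le_mul_of_nonneg_left hZ ht0.le
  have p0 : 1 ≤ M ^ 8 := one_le_pow₀ hM
  have p3 : M ^ 3 ≤ M ^ 8 := pow_le_pow_right₀ hM (by norm_num)
  have p5 : M ^ 5 ≤ M ^ 8 := pow_le_pow_right₀ hM (by norm_num)
  have p6 : M ^ 6 ≤ M ^ 8 := pow_le_pow_right₀ hM (by norm_num)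
  have z4 : (8 * M ^ 3 + 1 / 2 + 4 * M ^ 5 + 98 * M ^ 6 + 32 * M ^ 8) * t ≤ 150 * M ^ 8 * t := by
    gcongr; linarith
  norm_num at hmono
  norm_num at z1
  linarith

/-- Energy estimate for the discrete error `e`, given Galerkin orthogonality and a bound on the
weighted derivative of the interpolation error `w` in the case `ε ≤ ‖w‖`. -/
theorem energy_le_of_galerkin {S : Set ℝ} (hS : S.Countable)
    {a a' c u p s w w' e e' : ℝ → ℝ} {ε M t γ D : ℝ}
    (hε : 0 < ε) (hγ : 0 < γ) (hM : 1 ≤ M) (hD : 0 ≤ D)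
    (ha : PiecewiseC1 S a a') (hc : BddMeas c) (hu : BddMeas u)
    (hp : PiecewiseC1 S p s) (hw : PiecewiseC1 S w w') (he : PiecewiseC1 S e e')
    (haM : ∀ y ∈ Icc (-1 : ℝ) 1, |a y| ≤ M) (haM' : ∀ y ∈ Icc (-1 : ℝ) 1, |a' y| ≤ M)
    (hcM : ∀ y ∈ Icc (-1 : ℝ) 1, |c y| ≤ M)
    (hcoer : ∀ y ∈ Icc (-1 : ℝ) 1, γ ≤ c y - a' y / 2)
    (hel : e (-1) = 0) (her : e 1 = 0)
    (horth : ∫ y in (-1 : ℝ)..1, w' y * e' y = 0)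
    (hgal : ∫ y in (-1 : ℝ)..1, (ε * ((p y - w' y - e' y) * e' y)
      + a y * (p y - w' y - e' y) * e y + c y * (u y - w y - e y) * e y
      - (-ε * s y + a y * p y + c y * u y) * e y) = 0)
    (ht : ∫ y in (-1 : ℝ)..1, w y ^ 2 = t ^ 2) (ht0 : 0 ≤ t) (htM : t ≤ 2 * M)
    (hDt : ε ≤ t → ∫ y in (-1 : ℝ)..1, (a y * w' y) ^ 2 ≤ D * t) :
    ε * (∫ y in (-1 : ℝ)..1, e' y ^ 2) + ∫ y in (-1 : ℝ)..1, e y ^ 2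
      ≤ (2 + 2 / γ) * ((D / γ + 4 * M ^ 3 / γ + M ^ 2) * t) := by
  have hM0 : 0 < M := zero_lt_one.trans_le hM
  have hW3 := hp.mul he
  have hW4 := ha.mul (he.mul he)
  have hW5 := (ha.mul hw).mul he
  have hv3 := hW3.integral_deriv hS
  have hv4 := hW4.integral_deriv hS
  have hv5 := hW5.integral_deriv hS
  have := ha.bddMeas
  have := ha.bddMeas'
  have := hp.bddMeas
  have := hp.bddMeas'
  have := hw.bddMeas
  have := hw.bddMeas'
  have := he.bddMeas
  have := he.bddMeas'
  simp only [hel, her, mul_zero, sub_zero] at hv3 hv4 hv5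
  have ht2 : t ^ 2 ≤ 2 * M * t := by nlinarith
  have hE1 : 0 ≤ ∫ y in (-1 : ℝ)..1, e' y ^ 2 :=
    intervalIntegral.integral_nonneg (by norm_num) fun y _ => sq_nonneg _
  have hE2 : 0 ≤ ∫ y in (-1 : ℝ)..1, e y ^ 2 :=
    intervalIntegral.integral_nonneg (by norm_num) fun y _ => sq_nonneg _
  obtain ⟨P, hP⟩ : ∃ P : ℝ → ℝ, P = fun y => (-1) * (ε * ((p y - w' y - e' y) * e' y)
      + a y * (p y - w' y - e' y) * e y + c y * (u y - w y - e y) * e y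
      - (-ε * s y + a y * p y + c y * u y) * e y) + ε * (s y * e y + p y * e' y)
      - ε * (w' y * e' y) - 1 / 2 * (a' y * (e y * e y) + a y * (e' y * e y + e y * e' y)) :=
    ⟨_, rfl⟩
  have hPB : BddMeas P := by rw [hP]; fun_prop
  have hPint : ∫ y in (-1 : ℝ)..1, P y = 0 := by
    rw [hP, BddMeas.integral_sub (by fun_prop) (by fun_prop),
      BddMeas.integral_sub (by fun_prop) (by fun_prop),
      BddMeas.integral_add (by fun_prop) (by fun_prop),
      intervalIntegral.integral_const_mul, intervalIntegral.integral_const_mul,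
      intervalIntegral.integral_const_mul, intervalIntegral.integral_const_mul,
      hgal, hv3, hv4, horth]
    simp
  have hpt : ∀ y ∈ Icc (-1 : ℝ) 1, ε * e' y ^ 2 + γ * e y ^ 2
      ≤ P y - a y * w' y * e y - c y * w y * e y := fun y hy => by
    have h1 := mul_le_mul_of_nonneg_right (hcoer y hy) (sq_nonneg (e y))
    have h2 : P y - a y * w' y * e y - c y * w y * e y
        = ε * e' y ^ 2 + (c y - a' y / 2) * e y ^ 2 := by rw [hP]; ring
    linarith
  have hmain : ε / 2 * (∫ y in (-1 : ℝ)..1, e' y ^ 2) + γ / 2 * ∫ y in (-1 : ℝ)..1, e y ^ 2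
      ≤ (D / γ + 4 * M ^ 3 / γ + M ^ 2) * t := by
    rcases le_total ε t with hεt | htε
    · have hmono := BddMeas.integral_mono hS
        (g := fun y => ε / 2 * e' y ^ 2 + γ / 2 * e y ^ 2)
        (h := fun y => P y + 1 / γ * (a y * w' y) ^ 2 + M ^ 2 / γ * w y ^ 2)
        (by fun_prop) (by fun_prop) (fun y hy => by
          have hy' := Ioo_subset_Icc_self hy.1
          have h1 := hpt y hy'
          have h2 : -(a y * w' y * e y) ≤ γ / 4 * e y ^ 2 + 1 / γ * (a y * w' y) ^ 2 := by
            have : γ / 4 * e y ^ 2 + 1 / γ * (a y * w' y) ^ 2 + a y * w' y * e y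
              = (γ / 2 * e y + a y * w' y) ^ 2 / γ := by field_simp; ring
            have : 0 ≤ (γ / 2 * e y + a y * w' y) ^ 2 / γ := by positivity
            linarith
          have h3 : -(c y * w y * e y) ≤ γ / 4 * e y ^ 2 + M ^ 2 / γ * w y ^ 2 := by
            have : γ / 4 * e y ^ 2 + c y ^ 2 / γ * w y ^ 2 + c y * w y * e y
              = (γ / 2 * e y + c y * w y) ^ 2 / γ := by field_simp; ring
            have : 0 ≤ (γ / 2 * e y + c y * w y) ^ 2 / γ := by positivity
            have : c y ^ 2 / γ * w y ^ 2 ≤ M ^ 2 / γ * w y ^ 2 := by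
              gcongr ?_ / γ * _
              exact sq_le_sq.2 ((hcM y hy').trans (le_abs_self _))
            linarith
          have h4 : 0 ≤ ε * e' y ^ 2 := by positivity
          linarith)
      rw [BddMeas.integral_add (by fun_prop) (by fun_prop),
        BddMeas.integral_add (by fun_prop) (by fun_prop),
        BddMeas.integral_add (by fun_prop) (by fun_prop), hPint,
        intervalIntegral.integral_const_mul, intervalIntegral.integral_const_mul,
        intervalIntegral.integral_const_mul, intervalIntegral.integral_const_mul, ht] at hmono
      have h5 := mul_le_mul_of_nonneg_left (hDt hεt) (by positivity : 0 ≤ 1 / γ)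
      have h6 := mul_le_mul_of_nonneg_left ht2 (by positivity : 0 ≤ M ^ 2 / γ)
      have h7 : (D / γ + 4 * M ^ 3 / γ + M ^ 2) * t = 1 / γ * (D * t) + M ^ 2 / γ * (2 * M * t)
        + (2 * M ^ 3 / γ + M ^ 2) * t := by ring
      have h8 : 0 ≤ (2 * M ^ 3 / γ + M ^ 2) * t := by positivity
      linarith
    · have hmono := BddMeas.integral_mono hS
        (g := fun y => ε / 2 * e' y ^ 2 + γ / 2 * e y ^ 2)
        (h := fun y => P y - ((a' y * w y + a y * w' y) * e y + a y * w y * e' y)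
          + (2 * M ^ 2 / γ + M ^ 2 / (2 * ε)) * w y ^ 2)
        (by fun_prop) (by fun_prop) (fun y hy => by
          have hy' := Ioo_subset_Icc_self hy.1
          have h1 := hpt y hy'
          have hac : |a' y - c y| ≤ 2 * M := (abs_sub _ _).trans
            (by linarith [haM' y hy', hcM y hy'])
          have h2 : a y * w y * e' y ≤ ε / 2 * e' y ^ 2 + M ^ 2 / (2 * ε) * w y ^ 2 := by
            have : ε / 2 * e' y ^ 2 + a y ^ 2 / (2 * ε) * w y ^ 2 - a y * w y * e' y
              = (ε * e' y - a y * w y) ^ 2 / (2 * ε) := by field_simp; ring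
            have : 0 ≤ (ε * e' y - a y * w y) ^ 2 / (2 * ε) := by positivity
            have : a y ^ 2 / (2 * ε) * w y ^ 2 ≤ M ^ 2 / (2 * ε) * w y ^ 2 := by
              gcongr ?_ / _ * _
              exact sq_le_sq.2 ((haM y hy').trans (le_abs_self _))
            linarith
          have h3 : (a' y - c y) * w y * e y ≤ γ / 2 * e y ^ 2 + 2 * M ^ 2 / γ * w y ^ 2 := by
            have : γ / 2 * e y ^ 2 + (a' y - c y) ^ 2 / (2 * γ) * w y ^ 2
                - (a' y - c y) * w y * e y
              = (γ * e y - (a' y - c y) * w y) ^ 2 / (2 * γ) := by field_simp; ring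
            have : 0 ≤ (γ * e y - (a' y - c y) * w y) ^ 2 / (2 * γ) := by positivity
            have : (a' y - c y) ^ 2 / (2 * γ) * w y ^ 2 ≤ (2 * M) ^ 2 / (2 * γ) * w y ^ 2 := by
              gcongr ?_ / _ * _
              exact sq_le_sq.2 (hac.trans (le_abs_self _))
            have : (2 * M) ^ 2 / (2 * γ) * w y ^ 2 = 2 * M ^ 2 / γ * w y ^ 2 := by
              field_simp
            linarith
          linarith)
      rw [BddMeas.integral_add (by fun_prop) (by fun_prop),
        BddMeas.integral_add (by fun_prop) (by fun_prop),
        BddMeas.integral_sub (by fun_prop) (by fun_prop), hPint, hv5,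
        intervalIntegral.integral_const_mul, intervalIntegral.integral_const_mul,
        intervalIntegral.integral_const_mul, ht] at hmono
      have h5 : M ^ 2 / (2 * ε) * t ^ 2 ≤ M ^ 2 * t := by
        rw [div_mul_eq_mul_div, div_le_iff₀ (by positivity)]
        have : M ^ 2 * t * t ≤ M ^ 2 * t * (2 * ε) := by gcongr; linarith
        linarith
      have h6 := mul_le_mul_of_nonneg_left ht2 (by positivity : 0 ≤ 2 * M ^ 2 / γ)
      have h7 : (D / γ + 4 * M ^ 3 / γ + M ^ 2) * t
        = 2 * M ^ 2 / γ * (2 * M * t) + M ^ 2 * t + D / γ * t := by ring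
      have h8 : 0 ≤ D / γ * t := by positivity
      linarith
  have hsplit : ε * (∫ y in (-1 : ℝ)..1, e' y ^ 2) + ∫ y in (-1 : ℝ)..1, e y ^ 2
      = 2 * (ε / 2 * ∫ y in (-1 : ℝ)..1, e' y ^ 2)
        + 2 / γ * (γ / 2 * ∫ y in (-1 : ℝ)..1, e y ^ 2) := by field_simp
  have h1 : 0 ≤ ε / 2 * ∫ y in (-1 : ℝ)..1, e' y ^ 2 := by positivity
  have h2 : 0 ≤ γ / 2 * ∫ y in (-1 : ℝ)..1, e y ^ 2 := by positivity
  rw [hsplit, add_mul]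
  refine add_le_add (mul_le_mul_of_nonneg_left ?_ (by norm_num))
    (mul_le_mul_of_nonneg_left ?_ (by positivity)) <;> linarith

section Mesh
variable {N : ℕ} {x : ℤ → ℝ} {v : ℝ → ℝ}

theorem mesh_le (hx : ∀ i : ℤ, -(N : ℤ) ≤ i → i < N → x i < x (i + 1)) {i j : ℤ}
    (hi : -(N : ℤ) ≤ i) (hij : i ≤ j) (hj : j ≤ N) : x i ≤ x j := by
  induction j, hij using Int.leInduction with
  | base => exact le_rfl
  | succ k hk ih => exact (ih (by omega)).trans (hx k (by omega) (by omega)).le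

theorem mesh_mem_Icc (hl : x (-(N : ℤ)) = -1) (hr : x N = 1)
    (hx : ∀ i : ℤ, -(N : ℤ) ≤ i → i < N → x i < x (i + 1)) {i : ℤ}
    (hi : -(N : ℤ) ≤ i) (hi' : i ≤ N) : x i ∈ Icc (-1 : ℝ) 1 :=
  ⟨hl ▸ mesh_le hx le_rfl hi hi', hr ▸ mesh_le hx hi hi' le_rfl⟩

theorem mesh_sub_one_lt (hx : ∀ i : ℤ, -(N : ℤ) ≤ i → i < N → x i < x (i + 1)) {i : ℤ}
    (hi : -(N : ℤ) < i) (hi' : i ≤ N) : x (i - 1) < x i := by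
  simpa using hx (i - 1) (by omega) (by omega)

theorem exists_mesh_cell (hN : 1 ≤ N) (hl : x (-(N : ℤ)) = -1) (hr : x N = 1) {y : ℝ}
    (hy : y ∈ Icc (-1 : ℝ) 1) :
    ∃ i : ℤ, -(N : ℤ) < i ∧ i ≤ N ∧ y ∈ Icc (x (i - 1)) (x i) := by
  have key : ∀ j : ℤ, -(N : ℤ) + 1 ≤ j → j ≤ N → y ≤ x j →
      ∃ i : ℤ, -(N : ℤ) < i ∧ i ≤ N ∧ y ∈ Icc (x (i - 1)) (x i) := fun j hj => by
    induction j, hj using Int.leInduction with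
    | base =>
      intro hjN hyj
      exact ⟨-(N : ℤ) + 1, by omega, hjN, by simpa [hl] using hy.1, hyj⟩
    | succ k hk ih =>
      intro hkN hyk
      rcases le_total y (x k) with h | h
      · exact ih (by omega) h
      · exact ⟨k + 1, by omega, hkN, by simpa using h, hyk⟩
  exact key N (by omega) le_rfl (hr ▸ hy.2)

theorem MemVN1.sub {w : ℝ → ℝ} (hv : MemVN1 x N v) (hw : MemVN1 x N w) :
    MemVN1 x N fun y => v y - w y := by
  obtain ⟨hv1, hv2, hv3, hv4⟩ := hv
  obtain ⟨hw1, hw2, hw3, hw4⟩ := hw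
  refine ⟨hv1.sub hw1, by simp [hv2, hw2], by simp [hv3, hw3], fun i hi hi' y hy => ?_⟩
  simp only
  rw [hv4 i hi hi' y hy, hw4 i hi hi' y hy]
  ring

theorem MemVN1.hasDerivAt (hv : MemVN1 x N v) {i : ℤ} (hi : -(N : ℤ) < i) (hi' : i ≤ N)
    {y : ℝ} (hy : y ∈ Ioo (x (i - 1)) (x i)) :
    HasDerivAt v ((v (x i) - v (x (i - 1))) / (x i - x (i - 1))) y := by
  have h := (((hasDerivAt_id y).sub_const (x (i - 1))).const_mul
    ((v (x i) - v (x (i - 1))) / (x i - x (i - 1)))).const_add (v (x (i - 1)))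
  rw [mul_one] at h
  refine h.congr_of_eventuallyEq ?_
  filter_upwards [Ioo_mem_nhds hy.1 hy.2] with z hz
  exact hv.2.2.2 i hi hi' z (Ioo_subset_Icc_self hz)

theorem MemVN1.piecewiseC1 (hN : 1 ≤ N) (hl : x (-(N : ℤ)) = -1) (hr : x N = 1)
    (hv : MemVN1 x N v) : PiecewiseC1 (range x) v (deriv v) := by
  have key : ∀ y ∈ Ioo (-1 : ℝ) 1 \ range x, ∃ i : ℤ, -(N : ℤ) < i ∧ i ≤ N ∧
      HasDerivAt v ((v (x i) - v (x (i - 1))) / (x i - x (i - 1))) y := fun y hy => by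
    obtain ⟨i, hi, hi', h⟩ := exists_mesh_cell hN hl hr (Ioo_subset_Icc_self hy.1)
    refine ⟨i, hi, hi', hv.hasDerivAt hi hi' ⟨h.1.lt_of_ne ?_, h.2.lt_of_ne ?_⟩⟩
    · exact fun h' => hy.2 ⟨_, h'⟩
    · exact fun h' => hy.2 ⟨_, h'.symm⟩
  refine ⟨hv.1, ⟨(measurable_deriv v).aestronglyMeasurable,
    ∑ i ∈ Finset.Ioc (-(N : ℤ)) N, |(v (x i) - v (x (i - 1))) / (x i - x (i - 1))|, ?_⟩, ?_⟩
  · rw [restrict_Ioo_eq_restrict_Ioc.symm]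
    filter_upwards [ae_restrict_mem measurableSet_Ioo, (countable_range x).ae_notMem _]
      with y hy hyx
    obtain ⟨i, hi, hi', h⟩ := key y ⟨hy, hyx⟩
    rw [h.deriv]
    exact Finset.single_le_sum
      (f := fun i : ℤ => |(v (x i) - v (x (i - 1))) / (x i - x (i - 1))|)
      (fun _ _ => abs_nonneg _) (Finset.mem_Ioc.2 ⟨hi, hi'⟩)
  · intro y hy
    obtain ⟨i, _, _, h⟩ := key y hy
    exact h.differentiableAt.hasDerivAt

theorem MemVN1.abs_le_of_nodes (hN : 1 ≤ N) (hl : x (-(N : ℤ)) = -1) (hr : x N = 1)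
    (hx : ∀ i : ℤ, -(N : ℤ) ≤ i → i < N → x i < x (i + 1)) (hv : MemVN1 x N v) {K : ℝ}
    (hK : ∀ i : ℤ, -(N : ℤ) ≤ i → i ≤ N → |v (x i)| ≤ K) {y : ℝ} (hy : y ∈ Icc (-1 : ℝ) 1) :
    |v y| ≤ K := by
  obtain ⟨i, hi, hi', h⟩ := exists_mesh_cell hN hl hr hy
  have hlt := sub_pos.2 (mesh_sub_one_lt hx hi hi')
  rw [hv.2.2.2 i hi hi' y h]
  have h1 := abs_le.1 (hK (i - 1) (by omega) (by omega))
  have h2 := abs_le.1 (hK i (by omega) hi')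
  set θ := (y - x (i - 1)) / (x i - x (i - 1)) with hθ
  have h3 : 0 ≤ θ := div_nonneg (sub_nonneg.2 h.1) hlt.le
  have h4 : θ ≤ 1 := (div_le_one hlt).2 (by linarith [h.2])
  have h5 : v (x (i - 1)) + (v (x i) - v (x (i - 1))) / (x i - x (i - 1)) * (y - x (i - 1))
      = (1 - θ) * v (x (i - 1)) + θ * v (x i) := by rw [hθ]; field_simp; ring
  rw [h5, abs_le]
  constructor <;> nlinarith

/-- On each mesh interval the derivative of a mesh function is constant, so it is orthogonal to
derivatives of functions vanishing at all mesh points. -/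
theorem MemVN1.integral_deriv_mul_deriv_eq_zero {w w' : ℝ → ℝ}
    (hl : x (-(N : ℤ)) = -1) (hr : x N = 1)
    (hx : ∀ i : ℤ, -(N : ℤ) ≤ i → i < N → x i < x (i + 1)) (hv : MemVN1 x N v)
    (hvd : BddMeas (deriv v)) (hw : PiecewiseC1 (range x) w w')
    (hw0 : ∀ i : ℤ, -(N : ℤ) ≤ i → i ≤ N → w (x i) = 0) :
    ∫ y in (-1 : ℝ)..1, w' y * deriv v y = 0 := by
  have hwd := hw.bddMeas'
  have hprod : BddMeas fun y => w' y * deriv v y := by fun_prop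
  have hsub : ∀ i j : ℤ, -(N : ℤ) ≤ i → i ≤ N → -(N : ℤ) ≤ j → j ≤ N →
      uIcc (x i) (x j) ⊆ uIcc (-1 : ℝ) 1 := fun i j hi hi' hj hj' => by
    rw [uIcc_of_le (by norm_num : (-1 : ℝ) ≤ 1)]
    exact uIcc_subset_Icc (mesh_mem_Icc hl hr hx hi hi') (mesh_mem_Icc hl hr hx hj hj')
  have cell : ∀ i : ℤ, -(N : ℤ) < i → i ≤ N →
      ∫ y in x (i - 1)..x i, w' y * deriv v y = 0 := fun i hi hi' => by
    have hlt := mesh_sub_one_lt hx hi hi'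
    have m1 := mesh_mem_Icc hl hr hx (i := i - 1) (by omega) (by omega)
    have m2 := mesh_mem_Icc hl hr hx hi.le hi'
    rw [intervalIntegral.integral_congr_uIoo (g := fun y => w' y *
      ((v (x i) - v (x (i - 1))) / (x i - x (i - 1))))]
    · rw [intervalIntegral.integral_mul_const,
        integral_eq_of_hasDerivAt_off_countable_of_le w w' hlt.le (countable_range x)
          (hw.cont.mono (Icc_subset_Icc m1.1 m2.2))
          (fun y hy => hw.deriv y ⟨Ioo_subset_Ioo m1.1 m2.2 hy.1, hy.2⟩)
          (hwd.intervalIntegrable.mono_set (hsub _ _ (by omega) (by omega) hi.le hi')),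
        hw0 i hi.le hi', hw0 (i - 1) (by omega) (by omega)]
      simp
    · intro y hy
      rw [uIoo_of_le hlt.le] at hy
      simp only [(hv.hasDerivAt hi hi' hy).deriv]
  have key : ∀ j : ℤ, -(N : ℤ) ≤ j → j ≤ N →
      ∫ y in x (-(N : ℤ))..x j, w' y * deriv v y = 0 := fun j hj => by
    induction j, hj using Int.leInduction with
    | base => simp
    | succ k hk ih =>
      intro hkN
      have h := cell (k + 1) (by omega) hkN
      rw [add_sub_cancel_right] at h
      rw [← intervalIntegral.integral_add_adjacent_intervals (b := x k)
        (hprod.intervalIntegrable.mono_set (hsub _ _ (by omega) (by omega) hk (by omega)))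
        (hprod.intervalIntegrable.mono_set (hsub _ _ hk (by omega) (by omega) hkN)),
        ih (by omega), h, add_zero]
  simpa [hl, hr] using key N (by omega) le_rfl

end Mesh

theorem cusp_bounds {ε lam Cu y u p : ℝ} (hlam : 0 < lam) (hCu : 0 < Cu) (hε : 0 < ε)
    (hε1 : ε ≤ 1) (hy : |y| ≤ 1) (hu : |u| ≤ Cu * (1 + (ε ^ ((1 : ℝ) / 2) + |y|) ^ lam))
    (hp : |p| ≤ Cu * (1 + (ε ^ ((1 : ℝ) / 2) + |y|) ^ (lam - 1))) :
    |u| ≤ Cu * (1 + 2 ^ lam) ∧ |y| * |p| ≤ Cu * (1 + 2 ^ lam) := by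
  have h0 : 0 < ε ^ ((1 : ℝ) / 2) := Real.rpow_pos_of_pos hε _
  have h1 : ε ^ ((1 : ℝ) / 2) ≤ 1 := Real.rpow_le_one hε.le hε1 (by norm_num)
  have hy0 := abs_nonneg y
  set ρ := ε ^ ((1 : ℝ) / 2) + |y| with hρ
  have hρ0 : 0 < ρ := by positivity
  have h2 : ρ ^ lam ≤ 2 ^ lam := Real.rpow_le_rpow hρ0.le (by linarith) hlam.le
  refine ⟨hu.trans (by gcongr), ?_⟩
  have h3 : ρ ^ (lam - 1) * ρ = ρ ^ lam := by
    rw [Real.rpow_sub_one hρ0.ne', div_mul_cancel₀ _ hρ0.ne']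
  have h4 : 0 ≤ ρ ^ (lam - 1) := by positivity
  have h5 : ρ ^ (lam - 1) * |y| ≤ ρ ^ (lam - 1) * ρ := by gcongr; linarith
  calc |y| * |p| ≤ |y| * (Cu * (1 + ρ ^ (lam - 1))) := by gcongr
    _ = Cu * (|y| + ρ ^ (lam - 1) * |y|) := by ring
    _ ≤ Cu * (1 + 2 ^ lam) := by gcongr; linarith

theorem exists_bound_contDiffOn {g : ℝ → ℝ} (hg : ContDiffOn ℝ 1 g (Icc (-1) 1)) :
    ∃ L, 0 ≤ L ∧ ∀ y ∈ Icc (-1 : ℝ) 1, |g y| ≤ L ∧ |derivWithin g (Icc (-1) 1) y| ≤ L := by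
  obtain ⟨L₀, h₀⟩ := isCompact_Icc.exists_bound_of_continuousOn hg.continuousOn
  obtain ⟨L₁, h₁⟩ := isCompact_Icc.exists_bound_of_continuousOn
    (hg.continuousOn_derivWithin (uniqueDiffOn_Icc (by norm_num : (-1 : ℝ) < 1)) le_rfl)
  have hL : 0 ≤ L₀ := (norm_nonneg _).trans (h₀ 0 (by norm_num))
  exact ⟨max L₀ L₁, hL.trans (le_max_left _ _), fun y hy =>
    ⟨(h₀ y hy).trans (le_max_left _ _), (h₁ y hy).trans (le_max_right _ _)⟩⟩

/-- The supercloseness estimate with an explicit constant, for a cutoff `1 - a k` making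
`a (1 - a k)` vanish at `±1`. -/
theorem energyNorm_sub_le {a c f k k' u uI uN : ℝ → ℝ} {lam Cu γ ε L κ M : ℝ}
    (hlam : 0 < lam) (hCu : 0 < Cu) (hγ : 0 < γ)
    (ha : ContDiffOn ℝ 1 a (Icc (-1) 1)) (hc : ContDiffOn ℝ 1 c (Icc (-1) 1))
    (hf : ContDiffOn ℝ 1 f (Icc (-1) 1)) (ha0 : a 0 = 0)
    (hcoer : ∀ y ∈ Icc (-1 : ℝ) 1, γ ≤ c y - derivWithin a (Icc (-1) 1) y / 2)
    (hL0 : 0 ≤ L) (hκ0 : 0 ≤ κ)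
    (haL : ∀ y ∈ Icc (-1 : ℝ) 1, |a y| ≤ L ∧ |derivWithin a (Icc (-1) 1) y| ≤ L)
    (hcL : ∀ y ∈ Icc (-1 : ℝ) 1, |c y| ≤ L ∧ |derivWithin c (Icc (-1) 1) y| ≤ L)
    (hfL : ∀ y ∈ Icc (-1 : ℝ) 1, |f y| ≤ L ∧ |derivWithin f (Icc (-1) 1) y| ≤ L)
    (hk : ∀ S, PiecewiseC1 S k k') (hkκ : ∀ y ∈ Icc (-1 : ℝ) 1, |k y| ≤ κ)
    (hkκ' : ∀ y ∈ Icc (-1 : ℝ) 1, |k' y| ≤ κ)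
    (hkl : a (-1) * (1 - a (-1) * k (-1)) = 0) (hkr : a 1 * (1 - a 1 * k 1) = 0)
    (hM : M = 1 + L + κ + 3 * L * κ + (2 * L * (Cu * (1 + 2 ^ lam)) + L)
      + (3 * L ^ 2 * (Cu * (1 + 2 ^ lam)) + L ^ 2) + 2 * (Cu * (1 + 2 ^ lam)))
    (hε : 0 < ε) (hε1 : ε ≤ 1) {N : ℕ} {x : ℤ → ℝ} (hN : 1 ≤ N)
    (hl : x (-(N : ℤ)) = -1) (hr : x N = 1)
    (hx : ∀ i : ℤ, -(N : ℤ) ≤ i → i < N → x i < x (i + 1))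
    (hu : ContDiffOn ℝ 2 u (Icc (-1) 1)) (hul : u (-1) = 0) (hur : u 1 = 0)
    (hode : ∀ y ∈ Ioo (-1 : ℝ) 1,
      -ε * iteratedDerivWithin 2 u (Icc (-1) 1) y
        + a y * derivWithin u (Icc (-1) 1) y + c y * u y = f y)
    (hub : ∀ i : ℕ, i ≤ 1 → ∀ y ∈ Icc (-1 : ℝ) 1,
      |iteratedDerivWithin i u (Icc (-1) 1) y|
        ≤ Cu * (1 + (ε ^ ((1 : ℝ) / 2) + |y|) ^ (lam - i)))
    (huI : MemVN1 x N uI) (hint : ∀ i : ℤ, -(N : ℤ) ≤ i → i ≤ N → uI (x i) = u (x i))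
    (huN : MemVN1 x N uN)
    (hgal : ∀ v, MemVN1 x N v → Beps ε a c uN v = ∫ y in (-1 : ℝ)..1, f y * v y) :
    energyNorm ε (fun y => uI y - uN y)
      ≤ √((2 + 2 / γ) * (300 * M ^ 8 / γ + 4 * M ^ 3 / γ + M ^ 2))
        * √(√(∫ y in (-1 : ℝ)..1, (u y - uI y) ^ 2)) := by
  have hI : UniqueDiffOn ℝ (Icc (-1 : ℝ) 1) := uniqueDiffOn_Icc (by norm_num)
  set S := range x
  have hS : S.Countable := countable_range x
  obtain ⟨K, hK⟩ : ∃ K, K = Cu * (1 + (2 : ℝ) ^ lam) := ⟨_, rfl⟩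
  rw [← hK] at hM
  have hK0 : 0 ≤ K := by rw [hK]; positivity
  set p := derivWithin u (Icc (-1) 1) with hpdef
  set a' := derivWithin a (Icc (-1) 1) with ha'def
  set c' := derivWithin c (Icc (-1) 1) with hc'def
  set f' := derivWithin f (Icc (-1) 1) with hf'def
  have hbd : ∀ y ∈ Icc (-1 : ℝ) 1, |u y| ≤ K ∧ |y| * |p y| ≤ K := fun y hy => by
    rw [hK]
    refine cusp_bounds hlam hCu hε hε1 (abs_le.2 hy) ?_ ?_
    · simpa using hub 0 (by norm_num) y hy
    · simpa [iteratedDerivWithin_one] using hub 1 le_rfl y hy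
  have haX : ∀ y ∈ Icc (-1 : ℝ) 1, |a y| ≤ L * |y| := fun y hy => by
    simpa [ha0] using Convex.norm_image_sub_le_of_norm_derivWithin_le
      (ha.differentiableOn one_ne_zero) (fun z hz => (haL z hz).2) (convex_Icc _ _)
      (by norm_num : (0 : ℝ) ∈ Icc (-1 : ℝ) 1) hy
  have hap : ∀ y ∈ Icc (-1 : ℝ) 1, |a y * p y| ≤ L * K := fun y hy => by
    rw [abs_mul]
    calc |a y| * |p y| ≤ L * |y| * |p y| := by gcongr; exact haX y hy
      _ = L * (|y| * |p y|) := by ring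
      _ ≤ L * K := by gcongr; exact (hbd y hy).2
  have hp1 : ContDiffOn ℝ 1 p (Icc (-1) 1) := hu.derivWithin hI (by norm_num)
  have hA : PiecewiseC1 S a a' := .of_contDiffOn ha
  have hC : PiecewiseC1 S c c' := .of_contDiffOn hc
  have hF : PiecewiseC1 S f f' := .of_contDiffOn hf
  have hU : PiecewiseC1 S u p := .of_contDiffOn (hu.of_le (by norm_num))
  have hP0 : PiecewiseC1 S p (derivWithin p (Icc (-1) 1)) := .of_contDiffOn hp1
  have hA0 := hA.bddMeas
  have hA1 := hA.bddMeas'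
  have hC0 := hC.bddMeas
  have hF0 := hF.bddMeas
  have hU0 := hU.bddMeas
  have hp0 := hP0.bddMeas
  obtain ⟨s, hs⟩ : ∃ s : ℝ → ℝ, s = fun y => (a y * p y + c y * u y - f y) / ε := ⟨_, rfl⟩
  have hs0 : BddMeas s := by rw [hs]; fun_prop
  have hP : PiecewiseC1 S p s := by
    refine ⟨hP0.cont, hs0, fun y hy => ?_⟩
    have h := hP0.deriv y hy
    have h2 := hode y hy.1
    rw [iteratedDerivWithin_succ, iteratedDerivWithin_one, ← hpdef] at h2
    have h3 : s y = derivWithin p (Icc (-1) 1) y := by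
      rw [hs]
      field_simp
      linarith
    rwa [h3]
  have hQ := ((hA.mul hP).add (hC.mul hU)).sub hF
  have hQ' : ∀ y ∈ Ioo (-1 : ℝ) 1 \ S,
      a' y * p y + a y * s y + (c' y * u y + c y * p y) - f' y
      = a y * (a y * p y + c y * u y - f y) / ε + ((a' y + c y) * p y + c' y * u y - f' y) :=
    fun y _ => by rw [hs]; ring
  have hLκ : 0 ≤ L * κ := by positivity
  have hLK : 0 ≤ L * K := by positivity
  have hLLK : 0 ≤ L ^ 2 * K := by positivity
  have hLL : 0 ≤ L ^ 2 := by positivity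
  have hM1 : 1 ≤ M := by linarith
  have hM0 : 0 < M := by linarith
  have haM : ∀ y ∈ Icc (-1 : ℝ) 1, |a y| ≤ M := fun y hy => by linarith [haL y hy]
  have haM' : ∀ y ∈ Icc (-1 : ℝ) 1, |a' y| ≤ M := fun y hy => by linarith [haL y hy]
  have hcM : ∀ y ∈ Icc (-1 : ℝ) 1, |c y| ≤ M := fun y hy => by linarith [hcL y hy]
  have hkM : ∀ y ∈ Icc (-1 : ℝ) 1, |k y| ≤ M := fun y hy => by linarith [hkκ y hy]
  have hkM' : ∀ y ∈ Icc (-1 : ℝ) 1, |k' y| ≤ M := fun y hy => by linarith [hkκ' y hy]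
  have hmM : ∀ y ∈ Icc (-1 : ℝ) 1, |1 - a y * k y| ≤ M := fun y hy => by
    have h1 := abs_le.1 (abs_mul_le_of_abs_le (haL y hy).1 (hkκ y hy))
    rw [abs_le]; constructor <;> linarith
  have hmM' : ∀ y ∈ Icc (-1 : ℝ) 1, |0 - (a' y * k y + a y * k' y)| ≤ M := fun y hy => by
    have h1 := abs_le.1 (abs_mul_le_of_abs_le (haL y hy).2 (hkκ y hy))
    have h2 := abs_le.1 (abs_mul_le_of_abs_le (haL y hy).1 (hkκ' y hy))
    rw [abs_le]; constructor <;> linarith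
  have hqM : ∀ y ∈ Icc (-1 : ℝ) 1, |a y * p y + c y * u y - f y| ≤ M := fun y hy => by
    have h1 := abs_le.1 (hap y hy)
    have h2 := abs_le.1 (abs_mul_le_of_abs_le (hcL y hy).1 (hbd y hy).1)
    have h3 := abs_le.1 (hfL y hy).1
    rw [abs_le]; constructor <;> linarith
  have hRM : ∀ y ∈ Icc (-1 : ℝ) 1,
      |a y * ((a' y + c y) * p y + c' y * u y - f' y)| ≤ M := fun y hy => by
    have h1 := abs_le.1 (abs_mul_le_of_abs_le (haL y hy).2 (hap y hy))
    have h2 := abs_le.1 (abs_mul_le_of_abs_le (hcL y hy).1 (hap y hy))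
    have h3 := abs_le.1 (abs_mul_le_of_abs_le (abs_mul_le_of_abs_le (haL y hy).1
      (hcL y hy).2) (hbd y hy).1)
    have h4 := abs_le.1 (abs_mul_le_of_abs_le (haL y hy).1 (hfL y hy).2)
    rw [abs_le]; constructor <;> linarith
  have hUI := huI.piecewiseC1 hN hl hr
  have hUN := huN.piecewiseC1 hN hl hr
  have hEmem := huI.sub huN
  have hE := hEmem.piecewiseC1 hN hl hr
  have hW := hU.sub hUI
  have hwM : ∀ y ∈ Icc (-1 : ℝ) 1, |u y - uI y| ≤ M := fun y hy => by
    have h1 := abs_le.1 (hbd y hy).1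
    have h2 := abs_le.1 (huI.abs_le_of_nodes hN hl hr hx (K := K) (fun i hi hi' => by
      rw [hint i hi hi']
      exact (hbd _ (mesh_mem_Icc hl hr hx hi hi')).1) hy)
    rw [abs_le]; constructor <;> linarith
  have hw0 : ∀ i : ℤ, -(N : ℤ) ≤ i → i ≤ N → u (x i) - uI (x i) = 0 := fun i hi hi' => by
    rw [hint i hi hi', sub_self]
  have hnn : 0 ≤ ∫ y in (-1 : ℝ)..1, (u y - uI y) ^ 2 :=
    intervalIntegral.integral_nonneg (by norm_num) fun y _ => sq_nonneg _
  have hw2 := integral_sq_le_of_abs_le hW hwM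
  obtain ⟨t, ht⟩ : ∃ t, t = √(∫ y in (-1 : ℝ)..1, (u y - uI y) ^ 2) := ⟨_, rfl⟩
  have ht0 : 0 ≤ t := ht ▸ Real.sqrt_nonneg _
  have htsq : ∫ y in (-1 : ℝ)..1, (u y - uI y) ^ 2 = t ^ 2 := by rw [ht, Real.sq_sqrt hnn]
  have htM : t ≤ 2 * M := by
    rw [ht]
    exact Real.sqrt_le_iff.2 ⟨by positivity, by linarith [sq_nonneg M]⟩
  have hm : PiecewiseC1 S (fun y => 1 - a y * k y) (fun y => 0 - (a' y * k y + a y * k' y)) :=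
    PiecewiseC1.sub ⟨continuousOn_const, .const 0, fun y _ => hasDerivAt_const y 1⟩
      (hA.mul (hk S))
  have hDt : ε ≤ t → ∫ y in (-1 : ℝ)..1, (a y * (p y - deriv uI y)) ^ 2 ≤ 300 * M ^ 8 * t :=
    fun hεt => integral_sq_mul_deriv_le hS hε hM1 hA hQ (hk S) hP hW hUI.bddMeas' hQ'
      (fun y _ => by rw [hs]) (fun y _ => rfl) haM haM' hkM hkM' hqM hRM
      (by rw [huI.2.1, hul, sub_self]) (by rw [huI.2.2.1, hur, sub_self])
      (huI.integral_deriv_mul_deriv_eq_zero hl hr hx hUI.bddMeas' ((hA.mul hA).mul hW)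
        (fun i hi hi' => by simp only [hw0 i hi hi', mul_zero]))
      (integral_sq_mul_sq_le hS hε hM1 hA hQ hQ' haM haM' hqM hRM)
      (integral_sq_cutoff_le hS hε hM1 hA hQ hm hQ' haM haM' hmM hmM' hqM hRM hkl hkr)
      htsq hεt htM
  have hg := hgal _ hEmem
  have huN1 := hUN.bddMeas'
  have hE0 := hE.bddMeas
  have hE1 := hE.bddMeas'
  have huN0 := hUN.bddMeas
  have hu_I0 := hUI.bddMeas
  have hu_I1 := hUI.bddMeas'
  have hE' : ∀ y ∈ Ioo (-1 : ℝ) 1 \ S,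
      deriv (fun y => uI y - uN y) y = deriv uI y - deriv uN y := fun y hy =>
    ((hUI.deriv y hy).sub (hUN.deriv y hy)).deriv
  generalize hEdef : (fun y => uI y - uN y) = e at *
  have hev : ∀ y, e y = uI y - uN y := fun y => by rw [← hEdef]
  have hgal' : ∫ y in (-1 : ℝ)..1, (ε * ((p y - (p y - deriv uI y) - deriv e y) * deriv e y)
      + a y * (p y - (p y - deriv uI y) - deriv e y) * e y
      + c y * (u y - (u y - uI y) - e y) * e y
      - (-ε * s y + a y * p y + c y * u y) * e y) = 0 := by
    have hcongr : ∀ y ∈ Ioo (-1 : ℝ) 1 \ S,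
        ε * ((p y - (p y - deriv uI y) - deriv e y) * deriv e y)
          + a y * (p y - (p y - deriv uI y) - deriv e y) * e y
          + c y * (u y - (u y - uI y) - e y) * e y
          - (-ε * s y + a y * p y + c y * u y) * e y
        = ε * (deriv uN y * deriv e y) + a y * deriv uN y * e y + c y * uN y * e y
          - f y * e y := fun y hy => by
      have h1 : ε * s y = a y * p y + c y * u y - f y := by rw [hs]; field_simp
      have h2 : -ε * s y + a y * p y + c y * u y = f y := by linarith
      have h3 : p y - (p y - deriv uI y) - deriv e y = deriv uN y := by rw [hE' y hy]; ring
      have h4 : u y - (u y - uI y) - e y = uN y := by rw [hev]; ring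
      rw [h2, h3, h4]
    have hint0 : ∫ y in (-1 : ℝ)..1, (ε * (deriv uN y * deriv e y) + a y * deriv uN y * e y
        + c y * uN y * e y - f y * e y) = 0 := by
      rw [BddMeas.integral_sub (by fun_prop) (by fun_prop),
        BddMeas.integral_add (by fun_prop) (by fun_prop),
        BddMeas.integral_add (by fun_prop) (by fun_prop), intervalIntegral.integral_const_mul]
      simp only [Beps, ← hev] at hg
      linarith
    rw [← hint0]
    exact le_antisymm
      (BddMeas.integral_mono hS (by fun_prop) (by fun_prop) fun y hy => (hcongr y hy).le)
      (BddMeas.integral_mono hS (by fun_prop) (by fun_prop) fun y hy => (hcongr y hy).ge)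
  have hfin := energy_le_of_galerkin hS hε hγ hM1 (by positivity : 0 ≤ 300 * M ^ 8) hA hC0 hU0
    hP hW hE haM haM' hcM hcoer hEmem.2.1 hEmem.2.2.1
    (hEmem.integral_deriv_mul_deriv_eq_zero hl hr hx hE1 hW hw0) hgal' htsq ht0 htM hDt
  rw [energyNorm, ← ht, ← Real.sqrt_mul (by positivity)]
  exact Real.sqrt_le_sqrt (by linarith)

theorem exists_linear_cutoff (a : ℝ → ℝ) : ∃ (k k' : ℝ → ℝ) (κ : ℝ), 0 ≤ κ ∧
    (∀ S, PiecewiseC1 S k k') ∧ (∀ y ∈ Icc (-1 : ℝ) 1, |k y| ≤ κ) ∧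
    (∀ y ∈ Icc (-1 : ℝ) 1, |k' y| ≤ κ) ∧
    a (-1) * (1 - a (-1) * k (-1)) = 0 ∧ a 1 * (1 - a 1 * k 1) = 0 := by
  have hinv : ∀ r : ℝ, r * (1 - r * r⁻¹) = 0 := fun r => by
    rcases eq_or_ne r 0 with h | h
    · simp [h]
    · simp [mul_inv_cancel₀ h]
  generalize hα : (a 1)⁻¹ = α
  generalize hβ : (a (-1))⁻¹ = β
  refine ⟨fun y => (α - β) / 2 * y + (α + β) / 2, fun _ => (α - β) / 2, |α| + |β|,
    by positivity, fun S => ⟨by fun_prop, .const _, fun y _ => ?_⟩, fun y hy => ?_,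
    fun y _ => ?_, ?_, ?_⟩
  · simpa using ((hasDerivAt_id y).const_mul ((α - β) / 2)).add_const ((α + β) / 2)
  · have h1 := abs_le.1 (le_refl |α|)
    have h2 := abs_le.1 (le_refl |β|)
    rw [abs_le]
    constructor <;> nlinarith [hy.1, hy.2]
  · have h1 := abs_le.1 (le_refl |α|)
    have h2 := abs_le.1 (le_refl |β|)
    rw [abs_le]
    constructor <;> linarith
  · have h : (α - β) / 2 * -1 + (α + β) / 2 = β := by ring
    change a (-1) * (1 - a (-1) * ((α - β) / 2 * -1 + (α + β) / 2)) = 0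
    rw [h, ← hβ]
    exact hinv _
  · have h : (α - β) / 2 * 1 + (α + β) / 2 = α := by ring
    change a 1 * (1 - a 1 * ((α - β) / 2 * 1 + (α + β) / 2)) = 0
    rw [h, ← hα]
    exact hinv _

end

theorem superclose_sqrt_bound (a c f : ℝ → ℝ) (lam Cu γ : ℝ)
    (hlam : 0 < lam) (hCu : 0 < Cu) (hγ : 0 < γ)
    (ha : ContDiffOn ℝ 1 a (Set.Icc (-1) 1)) (hc : ContDiffOn ℝ 1 c (Set.Icc (-1) 1))
    (hf : ContDiffOn ℝ 1 f (Set.Icc (-1) 1)) (ha0 : a 0 = 0)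
    (hcoer : ∀ y ∈ Set.Icc (-1:ℝ) 1, γ ≤ c y - derivWithin a (Set.Icc (-1) 1) y / 2) :
    ∃ C : ℝ, 0 < C ∧
      ∀ ε : ℝ, 0 < ε → ε ≤ 1 →
      ∀ (N : ℕ) (x : ℤ → ℝ), 1 ≤ N →
        x (-(N:ℤ)) = -1 → x (N:ℤ) = 1 →
        (∀ i : ℤ, -(N:ℤ) ≤ i → i < N → x i < x (i+1)) →
      ∀ u uI uN : ℝ → ℝ,
        ContDiffOn ℝ 2 u (Set.Icc (-1) 1) → u (-1) = 0 → u 1 = 0 →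
        (∀ y ∈ Set.Ioo (-1:ℝ) 1,
          -ε * iteratedDerivWithin 2 u (Set.Icc (-1) 1) y
            + a y * derivWithin u (Set.Icc (-1) 1) y + c y * u y = f y) →
        (∀ i : ℕ, i ≤ 1 → ∀ y ∈ Set.Icc (-1:ℝ) 1,
          |iteratedDerivWithin i u (Set.Icc (-1) 1) y|
            ≤ Cu * (1 + (ε ^ ((1:ℝ)/2) + |y|) ^ (lam - i))) →
        MemVN1 x N uI → (∀ i : ℤ, -(N:ℤ) ≤ i → i ≤ N → uI (x i) = u (x i)) →
        MemVN1 x N uN →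
        (∀ v, MemVN1 x N v → Beps ε a c uN v = ∫ y in (-1:ℝ)..1, f y * v y) →
        energyNorm ε (fun y => uI y - uN y)
          ≤ C * Real.sqrt (Real.sqrt (∫ y in (-1:ℝ)..1, (u y - uI y)^2)) := by
  obtain ⟨La, hLa0, hLa⟩ := exists_bound_contDiffOn ha
  obtain ⟨Lc, hLc0, hLc⟩ := exists_bound_contDiffOn hc
  obtain ⟨Lf, hLf0, hLf⟩ := exists_bound_contDiffOn hf
  obtain ⟨k, k', κ, hκ0, hk, hkκ, hkκ', hkl, hkr⟩ := exists_linear_cutoff a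
  have hle : La ≤ La + Lc + Lf ∧ Lc ≤ La + Lc + Lf ∧ Lf ≤ La + Lc + Lf :=
    ⟨by linarith, by linarith, by linarith⟩
  have hL0 : 0 ≤ La + Lc + Lf := by positivity
  generalize La + Lc + Lf = L at hle hL0
  obtain ⟨M, hM⟩ : ∃ M, M = 1 + L + κ + 3 * L * κ + (2 * L * (Cu * (1 + 2 ^ lam)) + L)
      + (3 * L ^ 2 * (Cu * (1 + 2 ^ lam)) + L ^ 2) + 2 * (Cu * (1 + 2 ^ lam)) := ⟨_, rfl⟩
  have hM0 : 0 < M := by rw [hM]; positivity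
  refine ⟨√((2 + 2 / γ) * (300 * M ^ 8 / γ + 4 * M ^ 3 / γ + M ^ 2)), by positivity, ?_⟩
  intro ε hε hε1 N x hN hl hr hx u uI uN hu hul hur hode hub huI hint huN hgal
  exact energyNorm_sub_le hlam hCu hγ ha hc hf ha0 hcoer hL0 hκ0
    (fun y hy => ⟨(hLa y hy).1.trans hle.1, (hLa y hy).2.trans hle.1⟩)
    (fun y hy => ⟨(hLc y hy).1.trans hle.2.1, (hLc y hy).2.trans hle.2.1⟩)
    (fun y hy => ⟨(hLf y hy).1.trans hle.2.2, (hLf y hy).2.trans hle.2.2⟩)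
    hk hkκ hkκ' hkl hkr hM hε hε1 hN hl hr hx hu hul hur hode hub huI hint huN hgal
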